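/- For a tuple a with 0 ≤ a_i ≤ λ_i for all i, the regular subgroup R(a) is a characteristic subgroup of G if and only if a is canonical. -/

import Mathlib

/-- A subgroup is characteristic if it is mapped onto itself by every automorphism. -/
def IsCharSub {G : Type*} [AddGroup G] (H : AddSubgroup G) : Prop :=
  ∀ φ : AddAut G, AddSubgroup.map φ.toAddMonoidHom H = H

/-- A tuple `a` is canonical (w.r.t. the exponents `lam`) if `a` is weakly increasing and
`a (i+1) - a i ≤ lam (i+1) - lam i` for adjacent coordinates (written additively). -/
def IsCanonical {n : ℕ} (lam a : Fin n → ℕ) : Prop :=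
  ∀ i j : Fin n, (i : ℕ) + 1 = (j : ℕ) → a i ≤ a j ∧ a j + lam i ≤ a i + lam j

/-- The regular subgroup `R(a)`: elements whose `i`-th component is killed by `p ^ a i`. -/
def regSub (p : ℕ) {n : ℕ} (lam a : Fin n → ℕ) :
    AddSubgroup (Π i : Fin n, ZMod (p ^ lam i)) where
  carrier := {g | ∀ i, (p ^ a i : ℕ) • g i = 0}
  zero_mem' := by intro i; simp
  add_mem' := by
    intro x y hx hy i
    have : (p ^ a i : ℕ) • (x i + y i) = 0 := by
      rw [smul_add, hx i, hy i, add_zero]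
    simpa using this
  neg_mem' := by
    intro x hx i
    have : (p ^ a i : ℕ) • (-x i) = 0 := by
      rw [smul_neg, hx i, neg_zero]
    simpa using this

/-- The elements of `ZMod (p ^ l)` killed by `p ^ b` are the multiples of `p ^ (l - b)`. -/
theorem ZMod.exists_eq_prime_pow_smul {p l b : ℕ} (hp : p.Prime) (hb : b ≤ l)
    {x : ZMod (p ^ l)} (hx : (p ^ b : ℕ) • x = 0) :
    ∃ y : ZMod (p ^ l), x = (p ^ (l - b) : ℕ) • y := by
  have : NeZero (p ^ l) := ⟨(pow_pos hp.pos l).ne'⟩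
  obtain ⟨k, rfl⟩ := ZMod.natCast_zmod_surjective x
  rw [nsmul_eq_mul, ← Nat.cast_mul, ZMod.natCast_eq_zero_iff] at hx
  obtain ⟨c, rfl⟩ : p ^ (l - b) ∣ k := by
    refine Nat.dvd_of_mul_dvd_mul_left (pow_pos hp.pos b) ?_
    rwa [← pow_add, Nat.add_sub_of_le hb]
  exact ⟨(c : ZMod (p ^ l)), by rw [nsmul_eq_mul, Nat.cast_mul]⟩

/-- A sufficient condition for every homomorphism `ZMod (p ^ l) →+ ZMod (p ^ m)` to map the
`p ^ b`-torsion into the `p ^ c`-torsion. -/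
theorem ZMod.prime_pow_smul_map_eq_zero {p l m b c : ℕ} (hp : p.Prime) (hb : b ≤ l)
    (h : b ≤ c ∨ m + b ≤ c + l) (f : ZMod (p ^ l) →+ ZMod (p ^ m))
    {x : ZMod (p ^ l)} (hx : (p ^ b : ℕ) • x = 0) : (p ^ c : ℕ) • f x = 0 := by
  rcases h with h | h
  · rw [← map_nsmul, ← Nat.sub_add_cancel h, pow_add, mul_smul, hx, smul_zero, map_zero]
  · obtain ⟨y, rfl⟩ := ZMod.exists_eq_prime_pow_smul hp hb hx
    rw [map_nsmul, smul_smul, ← pow_add, nsmul_eq_mul,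
      (ZMod.natCast_eq_zero_iff _ _).2 (pow_dvd_pow p (by omega)), zero_mul]

/-- Multiplication by `p ^ d` induces a homomorphism `ZMod (p ^ l) →+ ZMod (p ^ m)`
when `m ≤ l + d`. -/
theorem ZMod.exists_addMonoidHom_prime_pow {p l m d : ℕ} (h : m ≤ l + d) :
    ∃ f : ZMod (p ^ l) →+ ZMod (p ^ m), ∀ k : ℕ, f k = ((p ^ d * k : ℕ) : ZMod (p ^ m)) := by
  let g : ℤ →+ ZMod (p ^ m) := zmultiplesHom _ ((p ^ d : ℕ) : ZMod (p ^ m))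
  have hg : g ((p ^ l : ℕ) : ℤ) = 0 := by
    rw [zmultiplesHom_apply, natCast_zsmul, nsmul_eq_mul, ← Nat.cast_mul, ← pow_add]
    exact (ZMod.natCast_eq_zero_iff _ _).2 (pow_dvd_pow p h)
  refine ⟨ZMod.lift (p ^ l) ⟨g, hg⟩, fun k => ?_⟩
  have := ZMod.lift_coe (p ^ l) ⟨g, hg⟩ (k : ℤ)
  rw [Int.cast_natCast] at this
  rw [this, zmultiplesHom_apply, natCast_zsmul, nsmul_eq_mul, ← Nat.cast_mul, mul_comm]

/-- The transvection of a product adding to coordinate `j` the image under `f` of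
coordinate `i ≠ j`. -/
def AddEquiv.piTransvection {ι : Type*} [DecidableEq ι] {M : ι → Type*}
    [∀ i, AddCommGroup (M i)] {i j : ι} (hij : i ≠ j) (f : M i →+ M j) :
    (∀ k, M k) ≃+ (∀ k, M k) where
  toFun g := g + Pi.single j (f (g i))
  invFun g := g - Pi.single j (f (g i))
  left_inv g := by simp [Pi.single_eq_of_ne hij]
  right_inv g := by simp [Pi.single_eq_of_ne hij]
  map_add' g h := by
    rw [Pi.add_apply, map_add, Pi.single_add]
    abel

theorem mem_regSub {p n : ℕ} {lam a : Fin n → ℕ} {g : Π i : Fin n, ZMod (p ^ lam i)} :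
    g ∈ regSub p lam a ↔ ∀ i, (p ^ a i : ℕ) • g i = 0 :=
  Iff.rfl

theorem isCharSub_of_map_le {G : Type*} [AddGroup G] {H : AddSubgroup G}
    (h : ∀ φ : G ≃+ G, ∀ g ∈ H, φ g ∈ H) : IsCharSub H := by
  intro φ
  ext x
  constructor
  · rintro ⟨g, hg, rfl⟩
    exact h φ g hg
  · intro hx
    exact ⟨AddEquiv.symm φ x, h (AddEquiv.symm φ) x hx, AddEquiv.apply_symm_apply φ x⟩

theorem IsCharSub.apply_mem {G : Type*} [AddGroup G] {H : AddSubgroup G} (h : IsCharSub H)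
    (φ : G ≃+ G) {g : G} (hg : g ∈ H) : φ g ∈ H := by
  have : φ g ∈ AddSubgroup.map (AddEquiv.toAddMonoidHom φ) H := ⟨g, hg, rfl⟩
  rwa [h φ] at this

theorem IsCharSub.smul_map_eq_zero {p n : ℕ} {lam a : Fin n → ℕ}
    (h : IsCharSub (regSub p lam a)) {i j : Fin n} (hij : i ≠ j)
    (f : ZMod (p ^ lam i) →+ ZMod (p ^ lam j)) {x : ZMod (p ^ lam i)}
    (hx : (p ^ a i : ℕ) • x = 0) : (p ^ a j : ℕ) • f x = 0 := by
  have hmem : (Pi.single i x : Π k : Fin n, ZMod (p ^ lam k)) ∈ regSub p lam a := by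
    rw [mem_regSub]
    intro k
    rcases eq_or_ne k i with rfl | hk
    · rwa [Pi.single_eq_same]
    · rw [Pi.single_eq_of_ne hk, smul_zero]
  have := mem_regSub.1 (h.apply_mem (AddEquiv.piTransvection hij f) hmem) j
  simpa [AddEquiv.piTransvection, Pi.single_eq_of_ne hij.symm] using this

theorem IsCharSub.add_le_add {p n : ℕ} (hp : p.Prime) {lam a : Fin n → ℕ}
    (h : IsCharSub (regSub p lam a)) {i j : Fin n} (hij : i ≠ j) (hi : a i ≤ lam i) {d : ℕ}
    (hd : lam j ≤ lam i + d) : lam j + a i ≤ a j + d + lam i := by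
  obtain ⟨f, hf⟩ := ZMod.exists_addMonoidHom_prime_pow (p := p) hd
  have hx : (p ^ a i : ℕ) • ((p ^ (lam i - a i) : ℕ) : ZMod (p ^ lam i)) = 0 := by
    rw [nsmul_eq_mul, ← Nat.cast_mul, ← pow_add, Nat.add_sub_of_le hi, ZMod.natCast_self]
  have hfx := h.smul_map_eq_zero hij f hx
  rw [hf, nsmul_eq_mul, ← Nat.cast_mul, ← pow_add, ← pow_add, ZMod.natCast_eq_zero_iff,
    Nat.pow_dvd_pow_iff_le_right hp.one_lt] at hfx
  omega

theorem IsCanonical.le_and_add_le_add {n : ℕ} {lam a : Fin n → ℕ} (h : IsCanonical lam a)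
    {i j : Fin n} (hij : i ≤ j) : a i ≤ a j ∧ a j + lam i ≤ a i + lam j := by
  obtain ⟨j, hj⟩ := j
  induction j with
  | zero =>
    obtain rfl : i = ⟨0, hj⟩ := le_antisymm hij (Nat.zero_le _)
    exact ⟨le_rfl, le_rfl⟩
  | succ k ih =>
    rcases hij.eq_or_lt with rfl | hlt
    · exact ⟨le_rfl, le_rfl⟩
    · have h₁ := ih (Nat.lt_of_succ_lt hj) (Nat.le_of_lt_succ hlt)
      have h₂ := h ⟨k, Nat.lt_of_succ_lt hj⟩ ⟨k + 1, hj⟩ rfl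
      omega

theorem IsCanonical.isCharSub_regSub {p n : ℕ} (hp : p.Prime) {lam a : Fin n → ℕ}
    (ha : ∀ i, a i ≤ lam i) (h : IsCanonical lam a) : IsCharSub (regSub p lam a) := by
  refine isCharSub_of_map_le fun φ g hg => mem_regSub.2 fun j => ?_
  rw [← Finset.univ_sum_single g, map_sum, Finset.sum_apply, Finset.smul_sum]
  refine Finset.sum_eq_zero fun i _ => ?_
  refine ZMod.prime_pow_smul_map_eq_zero hp (ha i) ?_
    ((Pi.evalAddMonoidHom _ j).comp (φ.toAddMonoidHom.comp (AddMonoidHom.single _ i)))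
    (mem_regSub.1 hg i)
  rcases le_total i j with hij | hji
  · exact Or.inl (h.le_and_add_le_add hij).1
  · have := (h.le_and_add_le_add hji).2
    omega

theorem stmt_5 (p : ℕ) (hp : p.Prime) (n : ℕ) (hn : 0 < n)
    (lam : Fin n → ℕ) (hlam1 : ∀ i, 1 ≤ lam i) (hlam : Monotone lam)
    (a : Fin n → ℕ) (ha : ∀ i, a i ≤ lam i) :
    IsCharSub (regSub p lam a) ↔ IsCanonical lam a := by
  refine ⟨fun h i j hij => ?_, IsCanonical.isCharSub_regSub hp ha⟩
  have hne : i ≠ j := by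
    rintro rfl
    omega
  have hle : lam i ≤ lam j := hlam (Fin.le_def.2 (by omega))
  have h₁ := h.add_le_add hp hne (ha i) (d := lam j - lam i) (by omega)
  have h₂ := h.add_le_add hp hne.symm (ha j) (d := 0) (by omega)
  omega
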